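/- arXiv:2004.00714 — 2 statements merged into one kernel-verified Lean document; each statement's English description precedes it below -/
import Mathlib

section
/- For the Sherrington–Kirkpatrick model, for every β > 0 and every decomposition N = N₁ + N₂ with N₁, N₂ ≥ 1, the quantity α_N(β) = −E[log Z_N(β)] is subadditive: α_N(β) ≤ α_{N₁}(β) + α_{N₂}(β). -/
open MeasureTheory ProbabilityTheory

/-- The law of the i.i.d. standard Gaussian couplings `(J_{ij})_{1 ≤ i,j ≤ N}`. -/
noncomputable def skCouplings (N : ℕ) : Measure (Fin N → Fin N → ℝ) :=
  Measure.pi fun _ => Measure.pi fun _ => gaussianReal 0 1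

/-- The Sherrington–Kirkpatrick Hamiltonian
`H_N(σ) = −(1/√N) Σ_{i,j} J_{ij} σ(i) σ(j)`, with configurations `σ ∈ {−1,1}^N`
encoded as `σ : Fin N → Bool` (where `true ↦ 1`, `false ↦ −1`). -/
noncomputable def skH (N : ℕ) (J : Fin N → Fin N → ℝ) (σ : Fin N → Bool) : ℝ :=
  -(1 / Real.sqrt N) * ∑ i, ∑ j,
    J i j * (if σ i then (1 : ℝ) else -1) * (if σ j then (1 : ℝ) else -1)

/-- The partition function `Z_N(β) = Σ_σ exp(−β H_N(σ))`. -/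
noncomputable def skZ (N : ℕ) (β : ℝ) (J : Fin N → Fin N → ℝ) : ℝ :=
  ∑ σ : Fin N → Bool, Real.exp (-β * skH N J σ)

/-- `α_N(β) = −E[log Z_N(β)]`. -/
noncomputable def skAlpha (N : ℕ) (β : ℝ) : ℝ :=
  -∫ J, Real.log (skZ N β J) ∂(skCouplings N)

/-- The law of a family of i.i.d. standard Gaussian variables indexed by `ι`. -/
noncomputable def gaussPi (ι : Type*) [Fintype ι] : Measure (ι → ℝ) :=
  Measure.pi fun _ => gaussianReal 0 1

instance (ι : Type*) [Fintype ι] : IsProbabilityMeasure (gaussPi ι) := by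
  unfold gaussPi; infer_instance

lemma hasDerivAt_gaussianPDFReal (x : ℝ) :
    HasDerivAt (gaussianPDFReal 0 1) (-(x * gaussianPDFReal 0 1 x)) x := by
  have h : HasDerivAt (fun x : ℝ => -(x - 0) ^ 2 / (2 * ((1 : NNReal) : ℝ))) (-x) x := by
    convert! ((((hasDerivAt_id x).sub_const 0).pow 2).neg).div_const
      (2 * ((1 : NNReal) : ℝ)) using 1
    simp
    ring
  convert! (h.exp).const_mul ((Real.sqrt (2 * Real.pi * (1 : NNReal)))⁻¹) using 1
  simp only [gaussianPDFReal]
  ring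

lemma integrable_id_gaussianReal_standard : Integrable (fun x : ℝ => x) (gaussianReal 0 1) :=
  (memLp_id_gaussianReal 1).integrable le_rfl

/-- Gaussian integration by parts in dimension one. -/
lemma integral_mul_gaussianReal {f f' : ℝ → ℝ} {C : ℝ} (hf : ∀ x, HasDerivAt f (f' x) x)
    (hf' : Continuous f') (hC : ∀ x, |f x| ≤ C) (hC' : ∀ x, |f' x| ≤ C) :
    ∫ x, x * f x ∂gaussianReal 0 1 = ∫ x, f' x ∂gaussianReal 0 1 := by
  have hfc : Continuous f := continuous_iff_continuousAt.2 fun x => (hf x).continuousAt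
  have hv : (1 : NNReal) ≠ 0 := one_ne_zero
  have hφ := integrable_gaussianPDFReal 0 1
  have hxφ : Integrable fun x : ℝ => x * gaussianPDFReal 0 1 x := by
    have := integrable_id_gaussianReal_standard
    rw [gaussianReal_of_var_ne_zero _ hv, integrable_withDensity_iff_integrable_smul'
      (measurable_gaussianPDF 0 1) (by simp [gaussianPDF])] at this
    simpa [toReal_gaussianPDF, mul_comm] using this
  have key := integral_mul_deriv_eq_deriv_mul_of_integrable (u := f) (u' := f')
    (v := gaussianPDFReal 0 1) (v' := fun x => -(x * gaussianPDFReal 0 1 x))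
    (fun x _ => hf x) (fun x _ => hasDerivAt_gaussianPDFReal x)
    (hxφ.neg.bdd_mul hfc.aestronglyMeasurable (.of_forall hC))
    (hφ.bdd_mul hf'.aestronglyMeasurable (.of_forall hC'))
    (hφ.bdd_mul hfc.aestronglyMeasurable (.of_forall hC))
  rw [integral_gaussianReal_eq_integral_smul hv, integral_gaussianReal_eq_integral_smul hv]
  simp only [smul_eq_mul]
  calc ∫ x, gaussianPDFReal 0 1 x * (x * f x)
      = -∫ x, f x * -(x * gaussianPDFReal 0 1 x) := by
        rw [← integral_neg]; congr 1; ext x; ring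
    _ = ∫ x, gaussianPDFReal 0 1 x * f' x := by
        rw [key, neg_neg]; congr 1; ext x; ring

lemma measurable_prod_update {ι : Type*} [DecidableEq ι] (i : ι) :
    Measurable fun p : (ι → ℝ) × ℝ => Function.update p.1 i p.2 := by
  refine measurable_pi_lambda _ fun j => ?_
  by_cases h : j = i
  · subst h; simpa using measurable_snd
  · simp only [Function.update_of_ne h]; fun_prop

section Pi

variable {ι : Type*} [Fintype ι]

lemma measurePreserving_gaussPi_eval (i : ι) :
    MeasurePreserving (fun g : ι → ℝ => g i) (gaussPi ι) (gaussianReal 0 1) :=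
  measurePreserving_eval _ i

lemma integrable_gaussPi_eval (i : ι) : Integrable (fun g : ι → ℝ => g i) (gaussPi ι) :=
  (measurePreserving_gaussPi_eval i).integrable_comp_of_integrable
    integrable_id_gaussianReal_standard

/-- Resampling one coordinate preserves the standard Gaussian law. -/
lemma measurePreserving_gaussPi_update [DecidableEq ι] (i : ι) :
    MeasurePreserving (fun p : (ι → ℝ) × ℝ => Function.update p.1 i p.2)
      ((gaussPi ι).prod (gaussianReal 0 1)) (gaussPi ι) where
  measurable := measurable_prod_update i
  map_eq := by
    refine (Measure.pi_eq fun s hs => ?_).symm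
    rw [Measure.map_apply (measurable_prod_update i) (.univ_pi hs)]
    have : (fun p : (ι → ℝ) × ℝ => Function.update p.1 i p.2) ⁻¹' Set.univ.pi s
        = (Set.univ.pi (Function.update s i Set.univ)) ×ˢ s i := by
      ext ⟨g, x⟩
      simp only [Set.mem_preimage, Set.mem_univ_pi, Set.mem_prod]
      constructor
      · refine fun h => ⟨fun j => ?_, by simpa using h i⟩
        by_cases hj : j = i
        · subst hj; simp
        · simpa [hj] using h j
      · rintro ⟨h, hx⟩ j
        by_cases hj : j = i
        · subst hj; simpa using hx
        · simpa [hj] using h j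
    rw [this, Measure.prod_prod, gaussPi, Measure.pi_pi,
      ← Finset.prod_erase_mul _ _ (Finset.mem_univ i),
      ← Finset.prod_erase_mul (a := i) _ (fun j => gaussianReal 0 1 (s j)) (Finset.mem_univ i)]
    simp only [Function.update_self, measure_univ, mul_one]
    congr 1
    refine Finset.prod_congr rfl fun j hj => ?_
    rw [Function.update_of_ne (Finset.ne_of_mem_erase hj)]

/-- Gaussian integration by parts. -/
lemma integral_mul_gaussPi [DecidableEq ι] (i : ι) {f f' : (ι → ℝ) → ℝ} {C : ℝ}
    (hf : ∀ g, HasDerivAt (fun x => f (Function.update g i x)) (f' g) (g i))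
    (hfc : Continuous f) (hf' : Continuous f') (hC : ∀ g, |f g| ≤ C) (hC' : ∀ g, |f' g| ≤ C) :
    ∫ g, g i * f g ∂gaussPi ι = ∫ g, f' g ∂gaussPi ι := by
  have hmp := measurePreserving_gaussPi_update i
  have hint : Integrable (fun g : ι → ℝ => g i * f g) (gaussPi ι) :=
    (integrable_gaussPi_eval i).mul_bdd hfc.aestronglyMeasurable (.of_forall hC)
  have hint' : Integrable f' (gaussPi ι) :=
    .of_bound hf'.aestronglyMeasurable C (.of_forall hC')
  have change : ∀ {F : (ι → ℝ) → ℝ}, Integrable F (gaussPi ι) → ∫ g, F g ∂gaussPi ι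
      = ∫ g, ∫ x, F (Function.update g i x) ∂gaussianReal 0 1 ∂gaussPi ι := by
    intro F hF
    rw [← hmp.map_eq, integral_map hmp.aemeasurable (by rw [hmp.map_eq]; exact hF.1), hmp.map_eq]
    exact integral_prod _ (hmp.integrable_comp_of_integrable hF)
  rw [change hint, change hint']
  congr 1
  ext g
  simp only [Function.update_self]
  refine integral_mul_gaussianReal (C := C) (fun x => ?_) ?_ (fun x => hC _) (fun x => hC' _)
  · simpa using hf (Function.update g i x)
  · exact hf'.comp (continuous_const.update i continuous_id)

/-- Restricting a standard Gaussian vector along an injection of index sets gives a standard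
Gaussian vector. -/
lemma measurePreserving_gaussPi_comp {κ : Type*} [Fintype κ] {e : κ → ι}
    (he : Function.Injective e) :
    MeasurePreserving (fun g : ι → ℝ => g ∘ e) (gaussPi ι) (gaussPi κ) where
  measurable := by fun_prop
  map_eq := by
    have h : iIndepFun (fun (i : ι) (g : ι → ℝ) => g i) (gaussPi ι) :=
      iIndepFun_pi (X := fun _ => id) fun _ => aemeasurable_id
    refine ((iIndepFun_iff_map_fun_eq_pi_map fun k => (measurable_pi_apply (e k)).aemeasurable).1 (h.precomp he)).trans ?_
    congr 1
    ext1 k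
    exact (measurePreserving_gaussPi_eval (e k)).map_eq

end Pi

lemma measurePreserving_skCouplings (N : ℕ) :
    MeasurePreserving (fun (g : Fin N × Fin N → ℝ) i j => g (i, j))
      (gaussPi (Fin N × Fin N)) (skCouplings N) where
  measurable := by fun_prop
  map_eq := by
    have := Measure.infinitePi_map_curry (ι := Fin N) (κ := Fin N)
      (fun _ _ => gaussianReal 0 1)
    simp only [Measure.infinitePi_eq_pi] at this
    exact this

section Gibbs

variable {S ι : Type*} [Fintype S] [Fintype ι]

/-- The partition function with energies `c s ⬝ᵥ g`, linear in the disorder `g`. -/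
noncomputable def partFun (c : S → ι → ℝ) (g : ι → ℝ) : ℝ := ∑ s, Real.exp (c s ⬝ᵥ g)

/-- The Gibbs weights attached to `partFun`. -/
noncomputable def gibbs (c : S → ι → ℝ) (g : ι → ℝ) (s : S) : ℝ :=
  Real.exp (c s ⬝ᵥ g) / partFun c g

variable (c : S → ι → ℝ)

lemma continuous_partFun : Continuous (partFun c) := by
  unfold partFun dotProduct; fun_prop

lemma abs_dotProduct_le (v g : ι → ℝ) : |v ⬝ᵥ g| ≤ ∑ i, |v i| * |g i| :=
  (Finset.abs_sum_le_sum_abs _ _).trans_eq (by simp [abs_mul])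

lemma gibbs_nonneg (g : ι → ℝ) (s : S) : 0 ≤ gibbs c g s :=
  div_nonneg (Real.exp_nonneg _) (Finset.sum_nonneg fun _ _ => Real.exp_nonneg _)

lemma integrable_weighted_abs :
    Integrable (fun g : ι → ℝ => ∑ s, ∑ i, |c s i| * |g i|) (gaussPi ι) :=
  integrable_finsetSum _ fun _ _ => integrable_finsetSum _ fun i _ =>
    (integrable_gaussPi_eval i).abs.const_mul _

variable [Nonempty S]

lemma partFun_pos (g : ι → ℝ) : 0 < partFun c g :=
  Finset.sum_pos (fun _ _ => Real.exp_pos _) Finset.univ_nonempty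

lemma sum_gibbs (g : ι → ℝ) : ∑ s, gibbs c g s = 1 := by
  simp only [gibbs, ← Finset.sum_div]
  exact div_self (partFun_pos c g).ne'

lemma gibbs_le_one (g : ι → ℝ) (s : S) : gibbs c g s ≤ 1 :=
  (Finset.single_le_sum (fun t _ => gibbs_nonneg c g t) (Finset.mem_univ s)).trans_eq
    (sum_gibbs c g)

lemma abs_gibbs_le_one (g : ι → ℝ) (s : S) : |gibbs c g s| ≤ 1 := by
  rw [abs_of_nonneg (gibbs_nonneg c g s)]
  exact gibbs_le_one c g s

lemma continuous_gibbs (s : S) : Continuous fun g => gibbs c g s := by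
  refine Continuous.div ?_ (continuous_partFun c) fun g => (partFun_pos c g).ne'
  unfold dotProduct; fun_prop

lemma continuous_log_partFun : Continuous fun g => Real.log (partFun c g) :=
  (continuous_partFun c).log fun g => (partFun_pos c g).ne'

lemma abs_log_partFun_le (g : ι → ℝ) :
    |Real.log (partFun c g)| ≤ Real.log (Fintype.card S) + ∑ s, ∑ i, |c s i| * |g i| := by
  have hle : ∀ s, |c s ⬝ᵥ g| ≤ ∑ s, ∑ i, |c s i| * |g i| := fun s =>
    (abs_dotProduct_le (c s) g).trans
      (Finset.single_le_sum (f := fun s => ∑ i, |c s i| * |g i|)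
        (fun t _ => by positivity) (Finset.mem_univ s))
  set B := ∑ s, ∑ i, |c s i| * |g i|
  have hcard : (1 : ℝ) ≤ Fintype.card S := by exact_mod_cast Fintype.card_pos (α := S)
  rw [abs_le]
  constructor
  · rw [Real.le_log_iff_exp_le (partFun_pos c g)]
    obtain ⟨s⟩ := ‹Nonempty S›
    calc Real.exp (-(Real.log (Fintype.card S) + B)) ≤ Real.exp (c s ⬝ᵥ g) := by
          have := (abs_le.1 (hle s)).1
          have := Real.log_nonneg hcard
          gcongr
          linarith
      _ ≤ partFun c g := Finset.single_le_sum (f := fun s => Real.exp (c s ⬝ᵥ g))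
          (fun t _ => Real.exp_nonneg _) (Finset.mem_univ s)
  · rw [Real.log_le_iff_le_exp (partFun_pos c g), Real.exp_add, Real.exp_log (by linarith)]
    calc partFun c g ≤ ∑ _s : S, Real.exp B :=
          Finset.sum_le_sum fun s _ => Real.exp_le_exp.2 ((le_abs_self _).trans (hle s))
      _ = _ := by simp

lemma integrable_log_partFun : Integrable (fun g => Real.log (partFun c g)) (gaussPi ι) :=
  ((integrable_const _).add (integrable_weighted_abs c)).mono'
    (continuous_log_partFun c).aestronglyMeasurable (.of_forall (abs_log_partFun_le c))

/-- The derivative of `log partFun` along a curve of coefficients. -/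
lemma hasDerivAt_log_partFun {c c' : ℝ → S → ι → ℝ} {t : ℝ}
    (hc : ∀ s i, HasDerivAt (fun t => c t s i) (c' t s i) t) (g : ι → ℝ) :
    HasDerivAt (fun t => Real.log (partFun (c t) g))
      (∑ s, gibbs (c t) g s * (c' t s ⬝ᵥ g)) t := by
  have hd : ∀ s, HasDerivAt (fun t => c t s ⬝ᵥ g) (c' t s ⬝ᵥ g) t := fun s =>
    HasDerivAt.fun_sum fun i _ => (hc s i).mul_const (g i)
  have hZ : HasDerivAt (fun t => partFun (c t) g)
      (∑ s, Real.exp (c t s ⬝ᵥ g) * (c' t s ⬝ᵥ g)) t :=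
    HasDerivAt.fun_sum fun s _ => (hd s).exp
  convert! hZ.log (partFun_pos (c t) g).ne' using 1
  rw [Finset.sum_div]
  exact Finset.sum_congr rfl fun s _ => by rw [gibbs]; ring

/-- The partial derivative of a Gibbs weight with respect to one disorder coordinate. -/
lemma hasDerivAt_gibbs_update [DecidableEq ι] (s : S) (i : ι) (g : ι → ℝ) :
    HasDerivAt (fun x => gibbs c (Function.update g i x) s)
      (gibbs c g s * (c s i - ∑ t, gibbs c g t * c t i)) (g i) := by
  have hd : ∀ s, HasDerivAt (fun x => c s ⬝ᵥ Function.update g i x) (c s i) (g i) := by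
    intro s
    have : ∀ j ∈ Finset.univ, HasDerivAt (fun x => c s j * Function.update g i x j)
        (c s j * Pi.single (M := fun _ => ℝ) i 1 j) (g i) := fun j _ =>
      ((hasDerivAt_pi.1 (hasDerivAt_update g i (g i))) j).const_mul _
    convert! HasDerivAt.fun_sum this using 1
    simp [Pi.single_apply]
  have hZ : HasDerivAt (fun x => partFun c (Function.update g i x))
      (∑ t, Real.exp (c t ⬝ᵥ g) * c t i) (g i) := by
    refine HasDerivAt.fun_sum fun t _ => ?_
    simpa using (hd t).exp
  have hne := (partFun_pos c g).ne'
  have h := (hd s).exp.fun_div hZ (by simpa using hne)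
  simp only [Function.update_eq_self] at h
  convert! h using 1
  have : ∑ t, gibbs c g t * c t i = (∑ t, Real.exp (c t ⬝ᵥ g) * c t i) / partFun c g := by
    rw [Finset.sum_div]
    exact Finset.sum_congr rfl fun t _ => by rw [gibbs]; ring
  rw [this, gibbs]
  field_simp

lemma integral_mul_gibbs (s : S) (i : ι) :
    ∫ g, g i * gibbs c g s ∂gaussPi ι
      = ∫ g, gibbs c g s * (c s i - ∑ t, gibbs c g t * c t i) ∂gaussPi ι := by
  classical
  have hcont := continuous_gibbs c
  have hsum : ∀ g, |∑ t, gibbs c g t * c t i| ≤ ∑ t, |c t i| := fun g =>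
    (Finset.abs_sum_le_sum_abs _ _).trans <| Finset.sum_le_sum fun t _ => by
      rw [abs_mul]
      exact mul_le_of_le_one_left (abs_nonneg _) (abs_gibbs_le_one c g t)
  refine integral_mul_gaussPi (C := 1 + |c s i| + ∑ t, |c t i|) i
    (hasDerivAt_gibbs_update c s i) (hcont s) (by fun_prop) (fun g => ?_) fun g => ?_
  · have : 0 ≤ |c s i| + ∑ t, |c t i| := by positivity
    linarith [abs_gibbs_le_one c g s]
  · rw [abs_mul]
    calc _ ≤ |c s i - ∑ t, gibbs c g t * c t i| :=
          mul_le_of_le_one_left (abs_nonneg _) (abs_gibbs_le_one c g s)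
      _ ≤ |c s i| + ∑ t, |c t i| := (abs_sub _ _).trans (by gcongr; exact hsum g)
      _ ≤ _ := by linarith

/-- The derivative of the expected free energy is a two-replica Gibbs average. -/
lemma integral_gibbs_dotProduct (d : S → ι → ℝ) :
    ∫ g, ∑ s, gibbs c g s * (d s ⬝ᵥ g) ∂gaussPi ι
      = ∫ g, ∑ s, gibbs c g s * (d s ⬝ᵥ c s - ∑ t, gibbs c g t * (d s ⬝ᵥ c t)) ∂gaussPi ι := by
  have hcont := continuous_gibbs c
  have hint : ∀ s i, Integrable (fun g : ι → ℝ => d s i * (g i * gibbs c g s)) (gaussPi ι) :=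
    fun s i => ((integrable_gaussPi_eval i).mul_bdd (hcont s).aestronglyMeasurable
      (.of_forall fun g => abs_gibbs_le_one c g s)).const_mul _
  have hbdd : ∀ s, ∀ {f : (ι → ℝ) → ℝ}, Integrable f (gaussPi ι) →
      Integrable (fun g => gibbs c g s * f g) (gaussPi ι) := fun s _ hf =>
    hf.bdd_mul (hcont s).aestronglyMeasurable (.of_forall fun g => abs_gibbs_le_one c g s)
  have hint' : ∀ s i, Integrable (fun g : ι → ℝ =>
      d s i * (gibbs c g s * (c s i - ∑ t, gibbs c g t * c t i))) (gaussPi ι) := fun s i =>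
    (hbdd s ((integrable_const _).sub (integrable_finsetSum _ fun t _ =>
      hbdd t (integrable_const _)))).const_mul _
  calc _ = ∫ g, ∑ s, ∑ i, d s i * (g i * gibbs c g s) ∂gaussPi ι := by
        congr 1; ext g
        refine Finset.sum_congr rfl fun s _ => ?_
        rw [dotProduct, Finset.mul_sum]
        exact Finset.sum_congr rfl fun i _ => by ring
    _ = ∑ s, ∑ i, d s i * ∫ g, g i * gibbs c g s ∂gaussPi ι := by
        rw [integral_finsetSum _ fun s _ => integrable_finsetSum _ fun i _ => hint s i]
        refine Finset.sum_congr rfl fun s _ => ?_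
        rw [integral_finsetSum _ fun i _ => hint s i]
        exact Finset.sum_congr rfl fun i _ => integral_const_mul _ _
    _ = ∫ g, ∑ s, ∑ i, d s i * (gibbs c g s * (c s i - ∑ t, gibbs c g t * c t i))
          ∂gaussPi ι := by
        rw [integral_finsetSum _ fun s _ => integrable_finsetSum _ fun i _ => hint' s i]
        refine Finset.sum_congr rfl fun s _ => ?_
        rw [integral_finsetSum _ fun i _ => hint' s i]
        refine Finset.sum_congr rfl fun i _ => ?_
        rw [integral_const_mul, integral_mul_gibbs]
    _ = _ := by
        congr 1; ext g
        refine Finset.sum_congr rfl fun s _ => ?_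
        simp only [dotProduct, mul_sub, Finset.sum_sub_distrib, Finset.mul_sum]
        congr 1
        · exact Finset.sum_congr rfl fun i _ => by ring
        · rw [Finset.sum_comm]
          exact Finset.sum_congr rfl fun t _ => Finset.sum_congr rfl fun i _ => by ring

/-- **Gaussian comparison for free energies.** If two families of centred Gaussian energies have
equal variances and the second has larger covariances, then its expected free energy is smaller. -/
theorem integral_log_partFun_le {K L : Type*} [Fintype K] [Fintype L]
    (a : S → K → ℝ) (b : S → L → ℝ) (hdiag : ∀ s, a s ⬝ᵥ a s = b s ⬝ᵥ b s)
    (hcov : ∀ s t, a s ⬝ᵥ a t ≤ b s ⬝ᵥ b t) :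
    ∫ g, Real.log (partFun b g) ∂gaussPi L ≤ ∫ g, Real.log (partFun a g) ∂gaussPi K := by
  let c : ℝ → S → K ⊕ L → ℝ := fun θ s =>
    Sum.elim (fun k => Real.cos θ * a s k) (fun l => Real.sin θ * b s l)
  let c' : ℝ → S → K ⊕ L → ℝ := fun θ s =>
    Sum.elim (fun k => -Real.sin θ * a s k) (fun l => Real.cos θ * b s l)
  let m : S → K ⊕ L → ℝ := fun s => Sum.elim (a s) (b s)
  let h : ℝ → ℝ := fun θ => ∫ g, Real.log (partFun (c θ) g) ∂gaussPi (K ⊕ L)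
  have hc : ∀ θ s i, HasDerivAt (fun θ => c θ s i) (c' θ s i) θ := by
    rintro θ s (k | l)
    · exact (Real.hasDerivAt_cos θ).mul_const _
    · exact (Real.hasDerivAt_sin θ).mul_const _
  have hm : ∀ θ s i, |c' θ s i| ≤ |m s i| := by
    rintro θ s (k | l)
    · simpa [c', m, abs_mul] using
        mul_le_of_le_one_left (abs_nonneg (a s k)) (Real.abs_sin_le_one θ)
    · simpa [c', m, abs_mul] using
        mul_le_of_le_one_left (abs_nonneg (b s l)) (Real.abs_cos_le_one θ)
  have hdot : ∀ θ s t, c' θ s ⬝ᵥ c θ t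
      = Real.sin θ * Real.cos θ * (b s ⬝ᵥ b t - a s ⬝ᵥ a t) := by
    intro θ s t
    simp only [c, c', dotProduct, Fintype.sum_sum_type, Sum.elim_inl, Sum.elim_inr, mul_sub,
      Finset.mul_sum]
    rw [sub_eq_add_neg, ← Finset.sum_neg_distrib, add_comm]
    congr 1 <;> exact Finset.sum_congr rfl fun _ _ => by ring
  have hderiv : ∀ θ, HasDerivAt h
      (∫ g, ∑ s, gibbs (c θ) g s * (c' θ s ⬝ᵥ g) ∂gaussPi (K ⊕ L)) θ := by
    intro θ
    refine (hasDerivAt_integral_of_dominated_loc_of_deriv_le (s := Set.univ)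
      (F' := fun θ g => ∑ s, gibbs (c θ) g s * (c' θ s ⬝ᵥ g))
      (bound := fun g => ∑ s, ∑ i, |m s i| * |g i|)
      Filter.univ_mem (.of_forall fun θ => (continuous_log_partFun _).aestronglyMeasurable)
      (integrable_log_partFun _) ?_ ?_ (integrable_weighted_abs m)
      (.of_forall fun g θ _ => hasDerivAt_log_partFun (hc θ) g)).2
    · have := continuous_gibbs (c θ)
      unfold dotProduct
      exact Continuous.aestronglyMeasurable (by fun_prop)
    · refine .of_forall fun g θ _ => (Finset.abs_sum_le_sum_abs _ _).trans ?_
      refine Finset.sum_le_sum fun s _ => ?_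
      rw [abs_mul]
      refine (mul_le_of_le_one_left (abs_nonneg _) (abs_gibbs_le_one _ _ _)).trans ?_
      refine (abs_dotProduct_le _ _).trans (Finset.sum_le_sum fun i _ => ?_)
      exact mul_le_mul_of_nonneg_right (hm θ s i) (abs_nonneg _)
  have hanti : AntitoneOn h (Set.Icc 0 (Real.pi / 2)) := by
    refine antitoneOn_of_deriv_nonpos (convex_Icc _ _)
      (fun θ _ => (hderiv θ).continuousAt.continuousWithinAt)
      (fun θ _ => (hderiv θ).differentiableAt.differentiableWithinAt) fun θ hθ => ?_
    rw [interior_Icc] at hθ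
    have hsin : 0 ≤ Real.sin θ := Real.sin_nonneg_of_nonneg_of_le_pi hθ.1.le
      (by linarith [hθ.2, Real.pi_pos])
    have hcos : 0 ≤ Real.cos θ := Real.cos_nonneg_of_neg_pi_div_two_le_of_le
      (by linarith [hθ.1, Real.pi_pos]) hθ.2.le
    rw [(hderiv θ).deriv, integral_gibbs_dotProduct]
    refine integral_nonpos fun g => Finset.sum_nonpos fun s _ => ?_
    refine mul_nonpos_of_nonneg_of_nonpos (gibbs_nonneg _ _ _) ?_
    simp only [hdot, hdiag, sub_self, mul_zero, zero_sub, neg_nonpos]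
    exact Finset.sum_nonneg fun t _ => mul_nonneg (gibbs_nonneg _ _ _)
      (mul_nonneg (mul_nonneg hsin hcos) (sub_nonneg.2 (hcov s t)))
  have hpi : 0 ≤ Real.pi / 2 := by positivity
  have h0 : h 0 = ∫ g, Real.log (partFun a g) ∂gaussPi K := by
    have hmp := measurePreserving_gaussPi_comp (ι := K ⊕ L) Sum.inl_injective
    rw [← hmp.map_eq, integral_map hmp.aemeasurable (continuous_log_partFun a).aestronglyMeasurable]
    simp [h, c, partFun, dotProduct]
  have h1 : h (Real.pi / 2) = ∫ g, Real.log (partFun b g) ∂gaussPi L := by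
    have hmp := measurePreserving_gaussPi_comp (ι := K ⊕ L) Sum.inr_injective
    rw [← hmp.map_eq, integral_map hmp.aemeasurable (continuous_log_partFun b).aestronglyMeasurable]
    simp [h, c, partFun, dotProduct]
  rw [← h0, ← h1]
  exact hanti ⟨le_rfl, hpi⟩ ⟨hpi, le_rfl⟩ hpi

end Gibbs

/-- The spin in `{-1, 1}` encoded by a Boolean. -/
def spin (x : Bool) : ℝ := if x then 1 else -1

lemma spin_mul_self (x : Bool) : spin x * spin x = 1 := by cases x <;> simp [spin]

/-- The coefficients of `-β H_N(σ)` as a linear form in the couplings. -/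
noncomputable def skCoeff (N : ℕ) (β : ℝ) (σ : Fin N → Bool) (p : Fin N × Fin N) : ℝ :=
  β / Real.sqrt N * (spin (σ p.1) * spin (σ p.2))

/-- The unnormalised overlap of two configurations. -/
def overlap {N : ℕ} (σ τ : Fin N → Bool) : ℝ := ∑ i, spin (σ i) * spin (τ i)

lemma overlap_self {N : ℕ} (σ : Fin N → Bool) : overlap σ σ = N := by
  simp [overlap, spin_mul_self]

lemma skCoeff_dotProduct (N : ℕ) (β : ℝ) (σ τ : Fin N → Bool) :
    skCoeff N β σ ⬝ᵥ skCoeff N β τ = β ^ 2 * (overlap σ τ ^ 2 / N) := by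
  have hsq : Real.sqrt N ^ 2 = N := Real.sq_sqrt N.cast_nonneg
  calc skCoeff N β σ ⬝ᵥ skCoeff N β τ
      = ∑ i, ∑ j, (β / Real.sqrt N) ^ 2 *
          ((spin (σ i) * spin (τ i)) * (spin (σ j) * spin (τ j))) := by
        rw [dotProduct, Fintype.sum_prod_type]
        refine Finset.sum_congr rfl fun i _ => Finset.sum_congr rfl fun j _ => ?_
        simp only [skCoeff]
        ring
    _ = (β / Real.sqrt N) ^ 2 * overlap σ τ ^ 2 := by
        simp only [← Finset.mul_sum]
        rw [sq (overlap σ τ), overlap, Finset.sum_mul]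
    _ = _ := by
        rw [div_pow, hsq]
        ring

lemma skZ_eq_partFun (N : ℕ) (β : ℝ) (g : Fin N × Fin N → ℝ) :
    skZ N β (fun i j => g (i, j)) = partFun (skCoeff N β) g := by
  refine Finset.sum_congr rfl fun σ _ => ?_
  congr 1
  rw [skH, dotProduct, Fintype.sum_prod_type, ← mul_assoc, Finset.mul_sum]
  refine Finset.sum_congr rfl fun i _ => ?_
  rw [Finset.mul_sum]
  refine Finset.sum_congr rfl fun j _ => ?_
  simp only [skCoeff, spin]
  ring

lemma skAlpha_eq (N : ℕ) (β : ℝ) :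
    skAlpha N β
      = -∫ g, Real.log (partFun (skCoeff N β) g) ∂gaussPi (Fin N × Fin N) := by
  have hmp := measurePreserving_skCouplings N
  have hcont : Continuous fun J : Fin N → Fin N → ℝ => Real.log (skZ N β J) := by
    have := (continuous_log_partFun (skCoeff N β)).comp
      (f := fun (J : Fin N → Fin N → ℝ) (p : Fin N × Fin N) => J p.1 p.2) (by fun_prop)
    simpa only [Function.comp_def, ← skZ_eq_partFun] using this
  rw [skAlpha, ← hmp.map_eq, integral_map hmp.aemeasurable hcont.aestronglyMeasurable]
  simp only [skZ_eq_partFun]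

/-- The coefficients of two decoupled systems of sizes `M` and `N`. -/
noncomputable def decoupledCoeff (M N : ℕ) (β : ℝ) (σ : Fin (M + N) → Bool) :
    (Fin M × Fin M) ⊕ (Fin N × Fin N) → ℝ :=
  Sum.elim (skCoeff M β fun i => σ (Fin.castAdd N i)) (skCoeff N β fun i => σ (Fin.natAdd M i))

lemma decoupledCoeff_dotProduct (M N : ℕ) (β : ℝ) (σ τ : Fin (M + N) → Bool) :
    decoupledCoeff M N β σ ⬝ᵥ decoupledCoeff M N β τ
      = β ^ 2 * (overlap (fun i => σ (Fin.castAdd N i)) (fun i => τ (Fin.castAdd N i)) ^ 2 / M)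
        + β ^ 2 * (overlap (fun i => σ (Fin.natAdd M i)) (fun i => τ (Fin.natAdd M i)) ^ 2 / N) := by
  rw [decoupledCoeff, decoupledCoeff, sumElim_dotProduct_sumElim, skCoeff_dotProduct,
    skCoeff_dotProduct]

lemma partFun_decoupledCoeff (M N : ℕ) (β : ℝ) (g : (Fin M × Fin M) ⊕ (Fin N × Fin N) → ℝ) :
    partFun (decoupledCoeff M N β) g
      = partFun (skCoeff M β) (g ∘ Sum.inl) * partFun (skCoeff N β) (g ∘ Sum.inr) := by
  rw [partFun, ← (Fin.appendEquiv M N).sum_comp, Fintype.sum_prod_type, partFun, partFun,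
    Finset.sum_mul_sum]
  refine Finset.sum_congr rfl fun σ _ => Finset.sum_congr rfl fun τ _ => ?_
  rw [← Real.exp_add]
  congr 1
  simp [decoupledCoeff, dotProduct, Fin.appendEquiv]

lemma integral_log_partFun_decoupledCoeff (M N : ℕ) (β : ℝ) :
    ∫ g, Real.log (partFun (decoupledCoeff M N β) g) ∂gaussPi _
      = -(skAlpha M β + skAlpha N β) := by
  have hl := measurePreserving_gaussPi_comp (ι := (Fin M × Fin M) ⊕ (Fin N × Fin N))
    Sum.inl_injective
  have hr := measurePreserving_gaussPi_comp (ι := (Fin M × Fin M) ⊕ (Fin N × Fin N))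
    Sum.inr_injective
  have hM := hl.integrable_comp_of_integrable (integrable_log_partFun (skCoeff M β))
  have hN := hr.integrable_comp_of_integrable (integrable_log_partFun (skCoeff N β))
  rw [skAlpha_eq, skAlpha_eq, ← hl.map_eq, ← hr.map_eq,
    integral_map hl.aemeasurable (continuous_log_partFun _).aestronglyMeasurable,
    integral_map hr.aemeasurable (continuous_log_partFun _).aestronglyMeasurable,
    neg_add, neg_neg, neg_neg]
  refine Eq.trans ?_ (integral_add hM hN)
  congr 1
  ext g
  rw [partFun_decoupledCoeff, Real.log_mul (partFun_pos _ _).ne' (partFun_pos _ _).ne']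

lemma add_sq_div_add_le {x y m n : ℝ} (hm : 0 < m) (hn : 0 < n) :
    (x + y) ^ 2 / (m + n) ≤ x ^ 2 / m + y ^ 2 / n := by
  rw [div_add_div _ _ hm.ne' hn.ne', div_le_div_iff₀ (by positivity) (by positivity)]
  nlinarith [sq_nonneg (n * x - m * y)]

/-- **Subadditivity for the SK model**: for every `β > 0` and `N = N₁ + N₂` with
`N₁, N₂ ≥ 1`, `α_N(β) ≤ α_{N₁}(β) + α_{N₂}(β)`. -/
theorem sk_subadditive (β : ℝ) (hβ : 0 < β) (N₁ N₂ : ℕ)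
    (h₁ : 1 ≤ N₁) (h₂ : 1 ≤ N₂) :
    skAlpha (N₁ + N₂) β ≤ skAlpha N₁ β + skAlpha N₂ β := by
  have hN₁ : (0 : ℝ) < N₁ := by exact_mod_cast h₁
  have hN₂ : (0 : ℝ) < N₂ := by exact_mod_cast h₂
  have h := integral_log_partFun_le (skCoeff (N₁ + N₂) β) (decoupledCoeff N₁ N₂ β)
    (fun σ => ?_) fun σ τ => ?_
  · rw [integral_log_partFun_decoupledCoeff] at h
    rw [skAlpha_eq (N₁ + N₂)]
    linarith
  · rw [skCoeff_dotProduct, decoupledCoeff_dotProduct]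
    simp only [overlap_self]
    push_cast
    field_simp
  · rw [skCoeff_dotProduct, decoupledCoeff_dotProduct, ← mul_add]
    refine mul_le_mul_of_nonneg_left ?_ (sq_nonneg β)
    rw [Nat.cast_add]
    convert! add_sq_div_add_le hN₁ hN₂ using 2
    rw [overlap, Fin.sum_univ_add, overlap, overlap]
end

section
/- Consider the GREM with infinitely many levels determined by reals α_i > 1 with Σ_{i=1}^∞ log α_i = log 2 and variances a_i > 0 with Σ_{i=1}^∞ a_i = 1; for N ∈ ℕ let k_i(N) = ⌊N log α_i / log 2⌋ and let α_N(β) = −E[log Z_{k(N)}(β)]. Then for every β > 0 and every decomposition N = N₁ + N₂ with N₁, N₂ ≥ 1, α_N(β) ≤ α_{N₁}(β) + α_{N₂}(β) − ( |k(N)| − |k(N₁)| − |k(N₂)| ) · log 2, where |k(M)| = Σ_i k_i(M); in particular α_N(β) is subadditive in N. -/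
open MeasureTheory ProbabilityTheory

/-- `gremKnat n k j = k₁ + ⋯ + k_j`: the number of spin coordinates determined by
the first `j` levels of the GREM tree (levels are indexed by `Fin n`, with the
level `i : Fin n` being the `(i+1)`-st level). -/
def gremKnat (n : ℕ) (k : Fin n → ℕ) (j : ℕ) : ℕ :=
  ∑ i ∈ Finset.univ.filter (fun i : Fin n => (i : ℕ) < j), k i

/-- The sample space of the GREM: one Gaussian variable `ε_i^{(s)}` for each level
`i` and each string `s ∈ {−1,1}^{K_i}` (encoded as `Fin K_i → Bool`). -/
abbrev GremSample (n : ℕ) (k : Fin n → ℕ) : Type :=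
  (i : Fin n) → ((Fin (gremKnat n k ((i : ℕ) + 1)) → Bool) → ℝ)

/-- The law of the disorder of the GREM: the `ε_i^{(s)}` are independent centered
Gaussians with variance `a_i`. -/
noncomputable def gremMeasure (n : ℕ) (k : Fin n → ℕ) (a : Fin n → ℝ) :
    Measure (GremSample n k) :=
  Measure.pi fun i => Measure.pi fun _ => gaussianReal 0 (a i).toNNReal

/-- The GREM Hamiltonian `H_k(σ) = −√|k| Σ_{i : k_i > 0} ε_i^{(σ↾K_i)}`,
where `σ↾K_i` is the restriction of `σ` to its first `K_i` coordinates. -/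
noncomputable def gremH (n : ℕ) (k : Fin n → ℕ) (ω : GremSample n k)
    (σ : Fin (∑ j, k j) → Bool) : ℝ :=
  -Real.sqrt (∑ j, k j) *
    ∑ i ∈ Finset.univ.filter (fun i : Fin n => 0 < k i),
      ω i (fun t => σ (Fin.castLE
        (by exact Finset.sum_le_sum_of_subset (Finset.filter_subset _ _)) t))

/-- The GREM partition function `Z_k(β) = Σ_{σ ∈ {−1,1}^{|k|}} exp(−β H_k(σ))`. -/
noncomputable def gremZ (n : ℕ) (k : Fin n → ℕ) (β : ℝ) (ω : GremSample n k) : ℝ :=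
  ∑ σ : Fin (∑ j, k j) → Bool, Real.exp (-β * gremH n k ω σ)

/-- `k_i(N) = ⌊N log α_i / log 2⌋` for the GREM with infinitely many levels. -/
noncomputable def gremSeqK (alpha : ℕ → ℝ) (N i : ℕ) : ℕ :=
  ⌊(N : ℝ) * Real.log (alpha i) / Real.log 2⌋₊

/-- `n(N)`: the number of levels of the `N`-th model, i.e. (the index of) the
largest level with `k_i(N) > 0`. -/
noncomputable def gremSeqLevels (alpha : ℕ → ℝ) (N : ℕ) : ℕ :=
  sSup {i : ℕ | 0 < gremSeqK alpha N i} + 1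

/-- `α_N(β) = −E[log Z_{k(N)}(β)]` for the GREM with infinitely many levels. -/
noncomputable def gremSeqAlpha (alpha a : ℕ → ℝ) (β : ℝ) (N : ℕ) : ℝ :=
  -∫ ω, Real.log (gremZ (gremSeqLevels alpha N)
        (fun i => gremSeqK alpha N (i : ℕ)) β ω)
    ∂(gremMeasure (gremSeqLevels alpha N)
        (fun i => gremSeqK alpha N (i : ℕ)) (fun i => a (i : ℕ)))

/-- `|k(N)| = Σᵢ k_i(N)` (as a real number; only finitely many terms are
nonzero). -/
noncomputable def gremSeqKtot (alpha : ℕ → ℝ) (N : ℕ) : ℝ :=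
  ∑' i, (gremSeqK alpha N i : ℝ)

/-- The log-partition function of a finite family of (negative) energies. -/
noncomputable def logSumExp {ι : Type*} [Fintype ι] (x : ι → ℝ) : ℝ :=
  Real.log (∑ σ, Real.exp (x σ))

/-- The law of the field `σ ↦ h (r σ)`, where `(h s)` are i.i.d. centered Gaussians of
variance `v` indexed by the labels `s`. -/
noncomputable def levelLaw {ι S : Type*} [Fintype S] (r : ι → S) (v : NNReal) :
    Measure (ι → ℝ) :=
  (Measure.pi fun _ : S => gaussianReal 0 v).map fun h σ => h (r σ)

/-- The law of a sum of `n` independent fields with given laws. -/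
noncomputable def fieldLaw {ι : Type*} (l : ℕ → Measure (ι → ℝ)) : ℕ → Measure (ι → ℝ)
  | 0 => Measure.dirac 0
  | n + 1 => fieldLaw l n ∗ l n

/-- A probability law of a random field whose coordinates are integrable. -/
structure IsIntegrableLaw {ι : Type*} (μ : Measure (ι → ℝ)) : Prop where
  prob : IsProbabilityMeasure μ
  integrable : ∀ σ, Integrable (fun x : ι → ℝ => x σ) μ

/-- Comparison of the expected log-partition functions in every external field. -/
def LogSumExpLE {ι : Type*} [Fintype ι] (μ ν : Measure (ι → ℝ)) : Prop :=
  ∀ c : ι → ℝ, ∫ x, logSumExp (c + x) ∂μ ≤ ∫ x, logSumExp (c + x) ∂ν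

section LogSumExp

lemma measurable_logSumExp {ι : Type*} [Fintype ι] :
    Measurable (logSumExp : (ι → ℝ) → ℝ) := by
  unfold logSumExp
  fun_prop

lemma measurable_logSumExp_add {ι : Type*} [Fintype ι] (c : ι → ℝ) :
    Measurable fun x => logSumExp (c + x) :=
  measurable_logSumExp.comp (by fun_prop)

variable {ι : Type*} [Fintype ι] [Nonempty ι]

lemma sum_exp_pos (x : ι → ℝ) : 0 < ∑ σ, Real.exp (x σ) :=
  Finset.sum_pos (fun _ _ => Real.exp_pos _) Finset.univ_nonempty

lemma logSumExp_mono {x y : ι → ℝ} (h : ∀ σ, x σ ≤ y σ) : logSumExp x ≤ logSumExp y :=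
  Real.log_le_log (sum_exp_pos x)
    (Finset.sum_le_sum fun σ _ => Real.exp_le_exp.2 (h σ))

lemma logSumExp_add_const (x : ι → ℝ) (t : ℝ) :
    logSumExp (fun σ => x σ + t) = logSumExp x + t := by
  unfold logSumExp
  simp_rw [Real.exp_add, ← Finset.sum_mul]
  rw [Real.log_mul (sum_exp_pos x).ne' (Real.exp_pos t).ne', Real.log_exp]

lemma abs_logSumExp_add_le (c x : ι → ℝ) :
    |logSumExp (c + x)| ≤ |logSumExp c| + ∑ σ, |x σ| := by
  have hx (σ : ι) : |x σ| ≤ ∑ τ, |x τ| :=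
    Finset.single_le_sum (f := fun τ => |x τ|) (fun _ _ => abs_nonneg _) (Finset.mem_univ σ)
  have h1 : logSumExp (c + x) ≤ logSumExp c + ∑ σ, |x σ| := by
    rw [← logSumExp_add_const]
    refine logSumExp_mono fun σ => ?_
    simpa using (le_abs_self _).trans (hx σ)
  have h2 : logSumExp c + -∑ σ, |x σ| ≤ logSumExp (c + x) := by
    rw [← logSumExp_add_const]
    refine logSumExp_mono fun σ => ?_
    simpa using neg_le.1 ((neg_le_abs _).trans (hx σ))
  rw [abs_le]
  constructor
  · linarith [neg_abs_le (logSumExp c)]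
  · linarith [le_abs_self (logSumExp c)]

lemma IsIntegrableLaw.integrable_logSumExp_add {μ : Measure (ι → ℝ)} (hμ : IsIntegrableLaw μ)
    (c : ι → ℝ) : Integrable (fun x => logSumExp (c + x)) μ := by
  have := hμ.prob
  refine Integrable.mono' (g := fun x => |logSumExp c| + ∑ σ, |x σ|) ?_
    (measurable_logSumExp_add c).aestronglyMeasurable
    (.of_forall fun x => abs_logSumExp_add_le c x)
  exact (integrable_const _).add (integrable_finsetSum _ fun σ _ => (hμ.integrable σ).abs)

lemma IsIntegrableLaw.integrable_logSumExp {μ : Measure (ι → ℝ)} (hμ : IsIntegrableLaw μ) :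
    Integrable logSumExp μ := by
  simpa using hμ.integrable_logSumExp_add 0

end LogSumExp

section Laws

variable {ι : Type*}

lemma IsIntegrableLaw.dirac_zero : IsIntegrableLaw (Measure.dirac (0 : ι → ℝ)) where
  prob := inferInstance
  integrable σ := by
    refine integrable_dirac' (measurable_pi_apply σ).stronglyMeasurable (by simp)

lemma IsIntegrableLaw.conv {μ ν : Measure (ι → ℝ)} (hμ : IsIntegrableLaw μ)
    (hν : IsIntegrableLaw ν) : IsIntegrableLaw (μ ∗ ν) := by
  have := hμ.prob
  have := hν.prob
  refine ⟨inferInstance, fun σ => ?_⟩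
  have hσ : Measurable fun x : ι → ℝ => x σ := measurable_pi_apply σ
  unfold Measure.conv
  rw [integrable_map_measure hσ.aestronglyMeasurable (by fun_prop)]
  exact ((hμ.integrable σ).comp_fst ν).add ((hν.integrable σ).comp_snd μ)

lemma IsIntegrableLaw.fieldLaw {l : ℕ → Measure (ι → ℝ)} (hl : ∀ i, IsIntegrableLaw (l i))
    (n : ℕ) : IsIntegrableLaw (fieldLaw l n) := by
  induction n with
  | zero => exact .dirac_zero
  | succ n ih => exact ih.conv (hl n)

lemma integrable_eval_pi_gaussianReal {S : Type*} [Fintype S] (v : NNReal) (s : S) :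
    Integrable (fun h : S → ℝ => h s) (Measure.pi fun _ : S => gaussianReal 0 v) := by
  have h := (measurePreserving_eval (fun _ : S => gaussianReal 0 v) s).integrable_comp
    (g := id) (by fun_prop)
  exact h.2 ((memLp_id_gaussianReal 1).integrable (by simp))

lemma integral_eval_pi_gaussianReal {S : Type*} [Fintype S] (v : NNReal) (s : S) :
    ∫ h : S → ℝ, h s ∂(Measure.pi fun _ : S => gaussianReal 0 v) = 0 := by
  have hm := (measurePreserving_eval (fun _ : S => gaussianReal 0 v) s).map_eq
  have h : ∫ x, x ∂(gaussianReal 0 v) = 0 := integral_id_gaussianReal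
  rw [← hm, integral_map (measurable_pi_apply s).aemeasurable (by fun_prop)] at h
  exact h

lemma IsIntegrableLaw.levelLaw {S : Type*} [Fintype S] (r : ι → S) (v : NNReal) :
    IsIntegrableLaw (levelLaw r v) := by
  have hr : Measurable fun (h : S → ℝ) σ => h (r σ) := by fun_prop
  refine ⟨Measure.isProbabilityMeasure_map hr.aemeasurable, fun σ => ?_⟩
  unfold _root_.levelLaw
  rw [integrable_map_measure (measurable_pi_apply σ).aestronglyMeasurable hr.aemeasurable]
  exact integrable_eval_pi_gaussianReal v (r σ)

lemma pi_conv {S : Type*} [Fintype S] (μ ν : Measure ℝ) [IsProbabilityMeasure μ]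
    [IsProbabilityMeasure ν] :
    (Measure.pi fun _ : S => μ ∗ ν) = (Measure.pi fun _ : S => μ) ∗ (Measure.pi fun _ : S => ν) := by
  have h := (measurePreserving_arrowProdEquivProdArrow ℝ ℝ S (fun _ => μ) (fun _ => ν)).map_eq
  unfold Measure.conv
  rw [← h, Measure.map_map (by fun_prop) (by fun_prop),
    ← Measure.pi_map_pi (f := fun _ (x : ℝ × ℝ) => x.1 + x.2) (fun _ => by fun_prop)]
  rfl

lemma map_comp_conv {ι' : Type*} (f : ι → ι') (μ ν : Measure (ι' → ℝ)) [IsProbabilityMeasure μ]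
    [IsProbabilityMeasure ν] :
    (μ ∗ ν).map (fun x σ => x (f σ)) =
      μ.map (fun x σ => x (f σ)) ∗ ν.map (fun x σ => x (f σ)) := by
  let F : (ι' → ℝ) →+ (ι → ℝ) :=
    { toFun := fun x σ => x (f σ), map_zero' := rfl, map_add' := fun _ _ => rfl }
  exact Measure.map_conv_addMonoidHom F
    (by change Measurable fun (x : ι' → ℝ) σ => x (f σ); fun_prop)

lemma levelLaw_add {S : Type*} [Fintype S] (r : ι → S) (v w : NNReal) :
    levelLaw r (v + w) = levelLaw r v ∗ levelLaw r w := by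
  unfold levelLaw
  rw [← map_comp_conv, ← pi_conv, gaussianReal_conv_gaussianReal, add_zero]

lemma map_levelLaw {ι' S : Type*} [Fintype S] (f : ι → ι') (r : ι' → S) (v : NNReal) :
    (levelLaw r v).map (fun x σ => x (f σ)) = levelLaw (fun σ => r (f σ)) v := by
  unfold levelLaw
  rw [Measure.map_map (by fun_prop) (by fun_prop)]
  rfl

lemma pi_map_comp_of_injective {S T : Type*} [Fintype S] [Fintype T] (ν : Measure ℝ)
    [IsProbabilityMeasure ν] {f : T → S} (hf : Function.Injective f) :
    (Measure.pi fun _ : S => ν).map (fun h t => h (f t)) = Measure.pi fun _ : T => ν := by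
  have h := (iIndepFun_pi (μ := fun _ : S => ν) (X := fun _ => id) fun _ => by fun_prop)
  have h' := (h.precomp hf).map_fun_eq_pi_map fun t => (measurable_pi_apply (f t)).aemeasurable
  refine h'.trans ?_
  congr 1
  ext1 t
  exact (measurePreserving_eval (fun _ : S => ν) (f t)).map_eq

lemma levelLaw_comp_of_injective {S T : Type*} [Fintype S] [Fintype T] {f : T → S}
    (hf : Function.Injective f) (r : ι → T) (v : NNReal) :
    levelLaw (fun σ => f (r σ)) v = levelLaw r v := by
  unfold levelLaw
  rw [← pi_map_comp_of_injective _ hf, Measure.map_map (by fun_prop) (by fun_prop)]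
  rfl

lemma map_fieldLaw {ι' : Type*} (f : ι → ι') {l : ℕ → Measure (ι' → ℝ)}
    (hl : ∀ i, IsIntegrableLaw (l i)) (n : ℕ) :
    (fieldLaw l n).map (fun x σ => x (f σ)) =
      fieldLaw (fun i => (l i).map fun x σ => x (f σ)) n := by
  induction n with
  | zero =>
    simp only [fieldLaw]
    rw [Measure.map_dirac' (by fun_prop)]
    rfl
  | succ n ih =>
    have := (IsIntegrableLaw.fieldLaw hl n).prob
    have := (hl n).prob
    simp only [fieldLaw]
    rw [map_comp_conv, ih]

lemma map_sum_pi_eq_fieldLaw (l : ℕ → Measure (ι → ℝ)) (hl : ∀ i, IsIntegrableLaw (l i)) (n : ℕ)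
    {Ω : Fin n → Type*} [∀ i, MeasurableSpace (Ω i)] (P : ∀ i, Measure (Ω i))
    [∀ i, IsProbabilityMeasure (P i)] (X : ∀ i, Ω i → ι → ℝ) (hX : ∀ i, Measurable (X i))
    (hlX : ∀ i, (P i).map (X i) = l i) :
    (Measure.pi P).map (fun ω => ∑ i, X i (ω i)) = fieldLaw l n := by
  induction n with
  | zero =>
    simp only [Finset.univ_eq_empty, Finset.sum_empty, fieldLaw]
    rw [Measure.map_const]
    simp
  | succ n ih =>
    have := (IsIntegrableLaw.fieldLaw hl n).prob
    have := (hl n).prob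
    have e := (measurePreserving_piFinSuccAbove P (Fin.last n)).map_eq
    have ih' := ih (fun j => P ((Fin.last n).succAbove j)) (fun j => X ((Fin.last n).succAbove j))
      (fun j => hX _) (fun j => by rw [hlX]; simp)
    have hs : Measurable fun ω : (∀ j, Ω ((Fin.last n).succAbove j)) =>
        ∑ j, X ((Fin.last n).succAbove j) (ω j) := by
      refine Finset.measurable_sum _ fun j _ => (hX _).comp (measurable_pi_apply j)
    rw [fieldLaw, Measure.conv_comm, ← ih', show l n = l (Fin.last n) from rfl, ← hlX,
      Measure.conv, Measure.map_prod_map _ _ (hX _) hs, ← e,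
      Measure.map_map ((hX _).prodMap hs) (MeasurableEquiv.measurable _),
      Measure.map_map (by fun_prop) (((hX _).prodMap hs).comp (MeasurableEquiv.measurable _))]
    congr 1
    ext1 ω
    rw [Fin.sum_univ_succAbove _ (Fin.last n)]
    rfl

end Laws

section Comparison

/-- A strictly positive weight on a finite type disintegrates along a surjection: there are
convex weights on the sections of `q` whose superposition is the identity. -/
lemma exists_section_weights {ι T : Type*} [Fintype ι] [Fintype T] [DecidableEq T] {q : ι → T}
    (hq : Function.Surjective q) {A : ι → ℝ} (hA : ∀ σ, 0 < A σ) :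
    ∃ W : (T → ι) → ℝ, (∀ ψ, 0 ≤ W ψ) ∧ ∑ ψ, W ψ = 1 ∧
      (∀ ψ, W ψ ≠ 0 → ∀ t, q (ψ t) = t) ∧
      ∀ y : ι → ℝ, ∑ ψ, W ψ * ∑ σ, A σ * y (ψ (q σ)) = ∑ σ, A σ * y σ := by
  classical
  let C : T → ℝ := fun t => ∑ σ with q σ = t, A σ
  have hC (t : T) : 0 < C t := by
    obtain ⟨σ, hσ⟩ := hq t
    exact Finset.sum_pos (fun σ _ => hA σ) ⟨σ, by simpa using hσ⟩
  let w : T → ι → ℝ := fun t σ => if q σ = t then A σ / C t else 0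
  have hw (t : T) : ∑ σ, w t σ = 1 := by
    simp only [w]
    rw [← Finset.sum_filter, ← Finset.sum_div]
    exact div_self (hC t).ne'
  have hmarg (t : T) (y : ι → ℝ) :
      ∑ ψ : T → ι, (∏ u, w u (ψ u)) * y (ψ t) = ∑ σ, w t σ * y σ := by
    have h := Fintype.prod_sum fun u σ => w u σ * if t = u then y σ else 1
    simp only [Finset.prod_mul_distrib, Finset.prod_ite_eq, Finset.mem_univ, if_true] at h
    rw [← h, Finset.prod_eq_single t]
    · simp
    · intro u _ hu
      simpa [hu.symm] using hw u
    · simp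
  refine ⟨fun ψ => ∏ t, w t (ψ t), fun ψ => Finset.prod_nonneg fun t _ => ?_, ?_, ?_, ?_⟩
  · simp only [w]
    split_ifs
    · exact (div_pos (hA _) (hC _)).le
    · exact le_rfl
  · rw [← Fintype.prod_sum]
    exact Finset.prod_eq_one fun t _ => hw t
  · intro ψ hψ t
    by_contra h
    exact hψ (Finset.prod_eq_zero (Finset.mem_univ t) (if_neg h))
  · intro y
    simp_rw [Finset.mul_sum]
    rw [Finset.sum_comm]
    simp_rw [mul_left_comm _ (A _) _, ← Finset.mul_sum, hmarg]
    simp_rw [Finset.mul_sum]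
    rw [Finset.sum_comm]
    refine Finset.sum_congr rfl fun τ _ => ?_
    have (σ : ι) : A σ * (w (q σ) τ * y τ) =
        (if q σ = q τ then A σ else 0) * (A τ / C (q τ) * y τ) := by
      simp only [w]
      by_cases h : q σ = q τ
      · simp [h]
      · simp [h, Ne.symm h]
    simp_rw [this]
    rw [← Finset.sum_mul, ← Finset.sum_filter]
    change C (q τ) * _ = _
    field_simp [(hC (q τ)).ne']

lemma integral_levelLaw {ι S : Type*} [Fintype ι] [Fintype S] (r : ι → S) (v : NNReal) (c : ι → ℝ) :
    ∫ x, logSumExp (c + x) ∂(levelLaw r v) =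
      ∫ h, logSumExp (fun σ => c σ + h (r σ)) ∂(Measure.pi fun _ : S => gaussianReal 0 v) := by
  have hr : Measurable fun (h : S → ℝ) σ => h (r σ) := by fun_prop
  unfold levelLaw
  rw [integral_map hr.aemeasurable (measurable_logSumExp_add c).aestronglyMeasurable]
  rfl

variable {ι : Type*} [Fintype ι] [Nonempty ι]

lemma integrable_logSumExp_add_comp {S : Type*} [Fintype S] (r : ι → S) (v : NNReal) (c : ι → ℝ) :
    Integrable (fun h : S → ℝ => logSumExp (fun σ => c σ + h (r σ)))
      (Measure.pi fun _ : S => gaussianReal 0 v) := by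
  have hr : Measurable fun (h : S → ℝ) σ => h (r σ) := by fun_prop
  have h := (IsIntegrableLaw.levelLaw r v).integrable_logSumExp_add c
  exact h.comp_measurable hr

/-- Refining the labels of a level increases the expected log-partition function. -/
lemma levelLaw_le_of_refines {S T : Type*} [Fintype S] [Fintype T] {q : ι → T} {r : ι → S}
    (hq : Function.Surjective q) (hqr : ∀ σ τ, r σ = r τ → q σ = q τ) (v : NNReal) :
    LogSumExpLE (levelLaw q v) (levelLaw r v) := by
  classical
  intro c
  rw [integral_levelLaw, integral_levelLaw]
  obtain ⟨W, hW0, hW1, hWq, hWsum⟩ :=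
    exists_section_weights hq (A := fun σ => Real.exp (c σ)) fun σ => Real.exp_pos _
  set I := ∫ g, logSumExp (fun σ => c σ + g (q σ)) ∂(Measure.pi fun _ : T => gaussianReal 0 v)
  have hsec (ψ : T → ι) : W ψ * ∫ h, logSumExp (fun σ => c σ + h (r (ψ (q σ))))
      ∂(Measure.pi fun _ : S => gaussianReal 0 v) = W ψ * I := by
    by_cases hψ : W ψ = 0
    · simp [hψ]
    have hinj : Function.Injective fun t => r (ψ t) := by
      intro t u htu
      simpa [hWq ψ hψ] using hqr _ _ htu
    congr 1
    simp only [I]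
    rw [← integral_levelLaw (fun σ => r (ψ (q σ))), ← integral_levelLaw q,
      levelLaw_comp_of_injective hinj]
  have hjensen (h : S → ℝ) : ∑ ψ, W ψ * logSumExp (fun σ => c σ + h (r (ψ (q σ)))) ≤
      logSumExp (fun σ => c σ + h (r σ)) := by
    have := strictConcaveOn_log_Ioi.concaveOn.le_map_sum (t := Finset.univ) (w := W)
      (p := fun ψ => ∑ σ, Real.exp (c σ + h (r (ψ (q σ))))) (fun ψ _ => hW0 ψ) hW1
      (fun ψ _ => sum_exp_pos _)
    simp only [smul_eq_mul, Real.exp_add] at this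
    rw [hWsum fun σ => Real.exp (h (r σ))] at this
    simpa only [logSumExp, Real.exp_add] using this
  calc I = ∑ ψ, W ψ * I := by rw [← Finset.sum_mul, hW1, one_mul]
    _ = ∑ ψ, W ψ * ∫ h, logSumExp (fun σ => c σ + h (r (ψ (q σ))))
        ∂(Measure.pi fun _ : S => gaussianReal 0 v) :=
      Finset.sum_congr rfl fun ψ _ => (hsec ψ).symm
    _ = ∫ h, ∑ ψ, W ψ * logSumExp (fun σ => c σ + h (r (ψ (q σ))))
        ∂(Measure.pi fun _ : S => gaussianReal 0 v) := by
      rw [integral_finsetSum]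
      · simp_rw [integral_const_mul]
      · exact fun ψ _ => (integrable_logSumExp_add_comp (fun σ => r (ψ (q σ))) v c).const_mul _
    _ ≤ _ := integral_mono
      (integrable_finsetSum _ fun ψ _ =>
        (integrable_logSumExp_add_comp (fun σ => r (ψ (q σ))) v c).const_mul _)
      (integrable_logSumExp_add_comp r v c) hjensen

/-- Adding an independent centered level increases the expected log-partition function. -/
lemma dirac_zero_le_levelLaw {S : Type*} [Fintype S] (r : ι → S) (v : NNReal) :
    LogSumExpLE (Measure.dirac 0) (levelLaw r v) := by
  intro c
  have h := levelLaw_le_of_refines (q := fun _ : ι => ()) (r := r)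
    (fun _ => ⟨Classical.arbitrary ι, rfl⟩) (fun _ _ _ => rfl) v c
  refine le_trans (le_of_eq ?_) h
  rw [integral_levelLaw]
  simp_rw [logSumExp_add_const]
  rw [integral_add (integrable_const _) (integrable_eval_pi_gaussianReal v ()),
    integral_eval_pi_gaussianReal,
    integral_dirac' _ _ (measurable_logSumExp_add c).stronglyMeasurable]
  simp

lemma integral_conv_logSumExp {μ ν : Measure (ι → ℝ)} (hμ : IsIntegrableLaw μ)
    (hν : IsIntegrableLaw ν) (c : ι → ℝ) :
    ∫ x, logSumExp (c + x) ∂(μ ∗ ν) = ∫ x, ∫ y, logSumExp ((c + x) + y) ∂ν ∂μ := by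
  have := hμ.prob
  have := hν.prob
  rw [integral_conv ((hμ.conv hν).integrable_logSumExp_add c)]
  simp_rw [add_assoc]

lemma LogSumExpLE.conv_left {μ ν ν' : Measure (ι → ℝ)} (hμ : IsIntegrableLaw μ)
    (hν : IsIntegrableLaw ν) (hν' : IsIntegrableLaw ν') (h : LogSumExpLE ν ν') :
    LogSumExpLE (μ ∗ ν) (μ ∗ ν') := by
  have := hμ.prob
  have hint {ρ : Measure (ι → ℝ)} (hρ : IsIntegrableLaw ρ) (c : ι → ℝ) :
      Integrable (fun x => ∫ y, logSumExp ((c + x) + y) ∂ρ) μ := by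
    have := hρ.prob
    have h := (hμ.conv hρ).integrable_logSumExp_add c
    unfold Measure.conv at h
    simpa [Function.comp_def, add_assoc] using
      (h.comp_measurable (by fun_prop)).integral_prod_left
  intro c
  rw [integral_conv_logSumExp hμ hν, integral_conv_logSumExp hμ hν']
  exact integral_mono (hint hν c) (hint hν' c) fun x => h (c + x)

lemma LogSumExpLE.conv {μ μ' ν ν' : Measure (ι → ℝ)} (hμ : IsIntegrableLaw μ)
    (hμ' : IsIntegrableLaw μ') (hν : IsIntegrableLaw ν) (hν' : IsIntegrableLaw ν')
    (h : LogSumExpLE μ μ') (h' : LogSumExpLE ν ν') : LogSumExpLE (μ ∗ ν) (μ' ∗ ν') := by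
  have := hμ.prob
  have := hμ'.prob
  have := hν'.prob
  have h1 := LogSumExpLE.conv_left hμ hν hν' h'
  have h2 := LogSumExpLE.conv_left hν' hμ hμ' h
  rw [Measure.conv_comm ν' μ, Measure.conv_comm ν' μ'] at h2
  exact fun c => (h1 c).trans (h2 c)

/-- One level with a fine label dominates two independent levels with coarser labels whose
variances add up to at most the variance of the fine level. -/
lemma levelLaw_conv_levelLaw_le {S T₁ T₂ : Type*} [Fintype S] [Fintype T₁] [Fintype T₂]
    {r : ι → S} {q₁ : ι → T₁} {q₂ : ι → T₂}
    (hq₁ : Function.Surjective q₁) (hq₂ : Function.Surjective q₂)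
    (hr₁ : ∀ σ τ, r σ = r τ → q₁ σ = q₁ τ) (hr₂ : ∀ σ τ, r σ = r τ → q₂ σ = q₂ τ)
    {v v₁ v₂ : NNReal} (hv : v₁ + v₂ ≤ v) :
    LogSumExpLE (levelLaw q₁ v₁ ∗ levelLaw q₂ v₂) (levelLaw r v) := by
  obtain ⟨w, rfl⟩ := exists_add_of_le hv
  have := (IsIntegrableLaw.levelLaw q₁ v₁).prob
  have := (IsIntegrableLaw.levelLaw q₂ v₂).prob
  have h := LogSumExpLE.conv (((IsIntegrableLaw.levelLaw q₁ v₁)).conv (.levelLaw q₂ v₂))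
    ((IsIntegrableLaw.levelLaw r v₁).conv (.levelLaw r v₂)) .dirac_zero (.levelLaw r w)
    (LogSumExpLE.conv (.levelLaw q₁ v₁) (.levelLaw r v₁) (.levelLaw q₂ v₂) (.levelLaw r v₂)
      (levelLaw_le_of_refines hq₁ hr₁ v₁) (levelLaw_le_of_refines hq₂ hr₂ v₂))
    (dirac_zero_le_levelLaw r w)
  rwa [Measure.conv_dirac_zero, ← levelLaw_add, ← levelLaw_add] at h

lemma fieldLaw_conv_fieldLaw_le {l l₁ l₂ : ℕ → Measure (ι → ℝ)}
    (hl : ∀ i, IsIntegrableLaw (l i)) (hl₁ : ∀ i, IsIntegrableLaw (l₁ i))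
    (hl₂ : ∀ i, IsIntegrableLaw (l₂ i)) (h : ∀ i, LogSumExpLE (l₁ i ∗ l₂ i) (l i)) (n : ℕ) :
    LogSumExpLE (fieldLaw l₁ n ∗ fieldLaw l₂ n) (fieldLaw l n) := by
  induction n with
  | zero =>
    simp only [fieldLaw, Measure.conv_dirac_zero]
    exact fun c => le_rfl
  | succ n ih =>
    have a₁ := IsIntegrableLaw.fieldLaw hl₁ n
    have a₂ := IsIntegrableLaw.fieldLaw hl₂ n
    have := a₁.prob
    have := a₂.prob
    have := (hl₁ n).prob
    have := (hl₂ n).prob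
    have e : fieldLaw l₁ (n + 1) ∗ fieldLaw l₂ (n + 1) =
        (fieldLaw l₁ n ∗ fieldLaw l₂ n) ∗ (l₁ n ∗ l₂ n) := by
      simp only [fieldLaw]
      rw [Measure.conv_assoc, Measure.conv_assoc, ← Measure.conv_assoc (l₁ n),
        Measure.conv_comm (l₁ n), Measure.conv_assoc (fieldLaw l₂ n)]
    rw [e]
    exact ih.conv (a₁.conv a₂) (.fieldLaw hl n) ((hl₁ n).conv (hl₂ n)) (hl n) (h n)

end Comparison

section Tensor

lemma sum_comp_of_injective {A B : Type*} [Fintype A] [Fintype B] [DecidableEq A] [DecidableEq B]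
    {e : A → B} (he : Function.Injective e) (F : (A → Bool) → ℝ) :
    ∑ σ : B → Bool, F (fun t => σ (e t)) =
      2 ^ (Fintype.card B - Fintype.card A) * ∑ τ, F τ := by
  classical
  let u : A ≃ {b // b ∈ Set.range e} := Equiv.ofInjective e he
  rw [← (Equiv.piEquivPiSubtypeProd (· ∈ Set.range e) fun _ => Bool).symm.sum_comp,
    Fintype.sum_prod_type, ← (u.arrowCongr (Equiv.refl Bool)).sum_comp]
  have h (τ : A → Bool) (ρ : {b // b ∉ Set.range e} → Bool) :
      (fun t => (Equiv.piEquivPiSubtypeProd (· ∈ Set.range e) fun _ => Bool).symm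
        (u.arrowCongr (Equiv.refl Bool) τ, ρ) (e t)) = τ := by
    ext1 t
    have : u.symm ⟨e t, t, rfl⟩ = t := u.symm_apply_apply t
    simp [this]
  simp_rw [h]
  have hc : Fintype.card {b // b ∉ Set.range e} = Fintype.card B - Fintype.card A := by
    rw [Fintype.card_subtype_compl, Fintype.card_congr u]
  simp [← hc, ← Finset.mul_sum]

variable {A₁ A₂ B : Type*} [Fintype A₁] [Fintype A₂] [Fintype B]
  [DecidableEq A₁] [DecidableEq A₂] [DecidableEq B]

lemma logSumExp_tensor {e₁ : A₁ → B} {e₂ : A₂ → B}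
    (he : Function.Injective (Sum.elim e₁ e₂)) (x : (A₁ → Bool) → ℝ) (y : (A₂ → Bool) → ℝ) :
    logSumExp (fun σ : B → Bool => x (fun t => σ (e₁ t)) + y (fun t => σ (e₂ t))) =
      ((Fintype.card B : ℝ) - Fintype.card A₁ - Fintype.card A₂) * Real.log 2
        + (logSumExp x + logSumExp y) := by
  have h := sum_comp_of_injective he fun τ =>
    Real.exp (x fun t => τ (.inl t)) * Real.exp (y fun t => τ (.inr t))
  have hsum : ∑ τ : A₁ ⊕ A₂ → Bool,
      Real.exp (x fun t => τ (.inl t)) * Real.exp (y fun t => τ (.inr t)) =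
        (∑ σ, Real.exp (x σ)) * ∑ σ, Real.exp (y σ) := by
    rw [← (Equiv.sumArrowEquivProdArrow A₁ A₂ Bool).symm.sum_comp, Fintype.sum_prod_type,
      Fintype.sum_mul_sum]
    rfl
  have hcard := Fintype.card_le_of_injective _ he
  rw [hsum] at h
  simp only [Sum.elim_inl, Sum.elim_inr, ← Real.exp_add] at h
  unfold logSumExp
  rw [h, Real.log_mul (by positivity) (mul_pos (sum_exp_pos x) (sum_exp_pos y)).ne',
    Real.log_mul (sum_exp_pos x).ne' (sum_exp_pos y).ne', Real.log_pow, Nat.cast_sub hcard,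
    Fintype.card_sum]
  push_cast
  ring

lemma integral_logSumExp_tensor {e₁ : A₁ → B} {e₂ : A₂ → B}
    (he : Function.Injective (Sum.elim e₁ e₂)) {μ : Measure ((A₁ → Bool) → ℝ)}
    {ν : Measure ((A₂ → Bool) → ℝ)} (hμ : IsIntegrableLaw μ) (hν : IsIntegrableLaw ν) :
    ∫ x, logSumExp x ∂((μ.map fun x (σ : B → Bool) => x (fun t => σ (e₁ t))) ∗
        (ν.map fun x (σ : B → Bool) => x (fun t => σ (e₂ t)))) =
      ((Fintype.card B : ℝ) - Fintype.card A₁ - Fintype.card A₂) * Real.log 2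
        + (∫ x, logSumExp x ∂μ + ∫ x, logSumExp x ∂ν) := by
  have := hμ.prob
  have := hν.prob
  have m₁ : Measurable fun (x : (A₁ → Bool) → ℝ) (σ : B → Bool) => x (fun t => σ (e₁ t)) := by
    fun_prop
  have m₂ : Measurable fun (x : (A₂ → Bool) → ℝ) (σ : B → Bool) => x (fun t => σ (e₂ t)) := by
    fun_prop
  rw [Measure.conv, Measure.map_prod_map _ _ m₁ m₂, Measure.map_map (by fun_prop) (m₁.prodMap m₂),
    integral_map (by fun_prop) measurable_logSumExp.aestronglyMeasurable]
  have h (z : ((A₁ → Bool) → ℝ) × ((A₂ → Bool) → ℝ)) :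
      logSumExp (((fun x : ((B → Bool) → ℝ) × ((B → Bool) → ℝ) => x.1 + x.2) ∘
        Prod.map (fun (x : (A₁ → Bool) → ℝ) (σ : B → Bool) => x (fun t => σ (e₁ t)))
          (fun (x : (A₂ → Bool) → ℝ) (σ : B → Bool) => x (fun t => σ (e₂ t)))) z) =
      ((Fintype.card B : ℝ) - Fintype.card A₁ - Fintype.card A₂) * Real.log 2
        + (logSumExp z.1 + logSumExp z.2) := logSumExp_tensor he z.1 z.2
  simp_rw [h]
  have i₁ := hμ.integrable_logSumExp.comp_fst ν
  have i₂ := hν.integrable_logSumExp.comp_snd μ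
  have i₁₂ : Integrable (fun z => logSumExp z.1 + logSumExp z.2) (μ.prod ν) := i₁.add i₂
  rw [integral_add (integrable_const _) i₁₂, integral_add i₁ i₂, integral_fun_fst,
    integral_fun_snd]
  simp

end Tensor

section Coordinates

/-- Two level structures whose sizes add up to at most those of a third one embed disjointly
into it, respecting the levels. -/
lemma exists_level_embeddings {κ κ₁ κ₂ : ℕ → ℕ} (h : ∀ i, κ₁ i + κ₂ i ≤ κ i) (n : ℕ) :
    ∃ E₁ E₂ : ℕ → ℕ,
      (∀ j ≤ n, ∀ x < ∑ i ∈ Finset.range j, κ₁ i, E₁ x < ∑ i ∈ Finset.range j, κ i) ∧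
      (∀ j ≤ n, ∀ x < ∑ i ∈ Finset.range j, κ₂ i, E₂ x < ∑ i ∈ Finset.range j, κ i) ∧
      Set.InjOn E₁ (Set.Iio (∑ i ∈ Finset.range n, κ₁ i)) ∧
      Set.InjOn E₂ (Set.Iio (∑ i ∈ Finset.range n, κ₂ i)) ∧
      ∀ x < ∑ i ∈ Finset.range n, κ₁ i, ∀ y < ∑ i ∈ Finset.range n, κ₂ i, E₁ x ≠ E₂ y := by
  induction n with
  | zero => exact ⟨id, id, by simp, by simp, by simp, by simp, by simp⟩
  | succ n ih =>
    obtain ⟨E₁, E₂, h₁, h₂, i₁, i₂, hd⟩ := ih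
    have b₁ := h₁ n le_rfl
    have b₂ := h₂ n le_rfl
    have mono (κ : ℕ → ℕ) {j : ℕ} (hj : j ≤ n) :
        ∑ i ∈ Finset.range j, κ i ≤ ∑ i ∈ Finset.range n, κ i :=
      Finset.sum_le_sum_of_subset (Finset.range_mono hj)
    have m₁ {j : ℕ} := mono κ₁ (j := j)
    have m₂ {j : ℕ} := mono κ₂ (j := j)
    have hn := h n
    simp only [Set.InjOn, Set.mem_Iio] at i₁ i₂ ⊢
    set K := ∑ i ∈ Finset.range n, κ i with hK
    set K₁ := ∑ i ∈ Finset.range n, κ₁ i with hK₁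
    set K₂ := ∑ i ∈ Finset.range n, κ₂ i with hK₂
    refine ⟨fun x => if x < K₁ then E₁ x else x - K₁ + K,
      fun x => if x < K₂ then E₂ x else x - K₂ + K + κ₁ n, ?_, ?_, ?_, ?_, ?_⟩
    · intro j hj x hx
      dsimp only
      rcases Nat.of_le_succ hj with hj | rfl
      · rw [if_pos (hx.trans_le (m₁ hj))]
        exact h₁ j hj x hx
      · rw [Finset.sum_range_succ] at hx ⊢
        split_ifs with hx'
        · have := b₁ x hx'
          omega
        · omega
    · intro j hj x hx
      dsimp only
      rcases Nat.of_le_succ hj with hj | rfl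
      · rw [if_pos (hx.trans_le (m₂ hj))]
        exact h₂ j hj x hx
      · rw [Finset.sum_range_succ] at hx ⊢
        split_ifs with hx'
        · have := b₂ x hx'
          omega
        · omega
    · intro x hx y hy hxy
      dsimp only at hxy
      split_ifs at hxy with hx' hy' hy'
      · exact i₁ hx' hy' hxy
      · have := b₁ x hx'
        omega
      · have := b₁ y hy'
        omega
      · omega
    · intro x hx y hy hxy
      dsimp only at hxy
      split_ifs at hxy with hx' hy' hy'
      · exact i₂ hx' hy' hxy
      · have := b₂ x hx'
        omega
      · have := b₂ y hy'
        omega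
      · omega
    · intro x hx y hy hxy
      rw [Finset.sum_range_succ] at hx hy
      dsimp only at hxy
      split_ifs at hxy with hx' hy' hy'
      · exact hd x hx' y hy' hxy
      · have := b₁ x hx'
        omega
      · have := b₂ y hy'
        omega
      · omega

end Coordinates

section Grem

/-- The variance of the contribution of level `i` to `-β H_k`, for a model with `M` spins. -/
noncomputable def gremLevelVar (κ : ℕ → ℕ) (a : ℕ → ℝ) (β : ℝ) (M i : ℕ) : NNReal :=
  NNReal.mk ((if 0 < κ i then β * √M else 0) ^ 2) (sq_nonneg _) * (a i).toNNReal

/-- The restriction of a configuration of `M` spins to the coordinates determined by the first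
`i + 1` levels. -/
def gremLabel (κ : ℕ → ℕ) (M i : ℕ) (σ : Fin M → Bool) :
    {t : Fin M // (t : ℕ) < ∑ j ∈ Finset.range (i + 1), κ j} → Bool :=
  fun t => σ t

/-- The law of the contribution of level `i` to `-β H_k`, for a model with `M` spins. -/
noncomputable def gremLevelLaw (κ : ℕ → ℕ) (a : ℕ → ℝ) (β : ℝ) (M i : ℕ) :
    Measure ((Fin M → Bool) → ℝ) :=
  levelLaw (gremLabel κ M i) (gremLevelVar κ a β M i)

lemma isIntegrableLaw_gremLevelLaw (κ : ℕ → ℕ) (a : ℕ → ℝ) (β : ℝ) (M i : ℕ) :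
    IsIntegrableLaw (gremLevelLaw κ a β M i) :=
  .levelLaw _ _

lemma levelLaw_zero {ι S : Type*} [Fintype S] (r : ι → S) :
    levelLaw r 0 = Measure.dirac 0 := by
  unfold levelLaw
  rw [gaussianReal_zero_var, ← Measure.infinitePi_eq_pi, Measure.infinitePi_dirac,
    Measure.map_dirac' (by fun_prop)]
  rfl

lemma gremLevelVar_eq_zero {κ : ℕ → ℕ} {i : ℕ} (hi : κ i = 0) (a : ℕ → ℝ) (β : ℝ) (M : ℕ) :
    gremLevelVar κ a β M i = 0 := by
  have h : NNReal.mk ((if 0 < κ i then β * √M else 0) ^ 2) (sq_nonneg _) = 0 :=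
    NNReal.eq (by simp [hi])
  rw [gremLevelVar, h, zero_mul]

lemma gremLevelVar_add_le {κ κ₁ κ₂ : ℕ → ℕ} (h : ∀ i, κ₁ i + κ₂ i ≤ κ i) {M M₁ M₂ : ℕ}
    (hM : M₁ + M₂ ≤ M) (a : ℕ → ℝ) (β : ℝ) (i : ℕ) :
    gremLevelVar κ₁ a β M₁ i + gremLevelVar κ₂ a β M₂ i ≤ gremLevelVar κ a β M i := by
  unfold gremLevelVar
  rw [← add_mul]
  gcongr
  rw [← NNReal.coe_le_coe]
  push_cast
  by_cases hi : 0 < κ i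
  · have aux (p : Prop) [Decidable p] (m : ℕ) : (if p then β * √m else 0) ^ 2 ≤ β ^ 2 * m := by
      split_ifs
      · rw [mul_pow, Real.sq_sqrt (Nat.cast_nonneg m)]
      · simpa using by positivity
    rw [if_pos hi, mul_pow β (√M), Real.sq_sqrt (Nat.cast_nonneg M)]
    have hM' : (M₁ : ℝ) + M₂ ≤ M := by exact_mod_cast hM
    nlinarith [aux (0 < κ₁ i) M₁, aux (0 < κ₂ i) M₂, sq_nonneg β]
  · have := h i
    rw [if_neg (by omega), if_neg (by omega), if_neg hi]
    simp

lemma fieldLaw_gremLevelLaw_of_le {κ : ℕ → ℕ} {n m : ℕ} (hκ : ∀ i, n ≤ i → κ i = 0) (hnm : n ≤ m)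
    (a : ℕ → ℝ) (β : ℝ) (M : ℕ) :
    fieldLaw (gremLevelLaw κ a β M) m = fieldLaw (gremLevelLaw κ a β M) n := by
  induction m, hnm using Nat.le_induction with
  | base => rfl
  | succ m hm ih =>
    have := (IsIntegrableLaw.fieldLaw (isIntegrableLaw_gremLevelLaw κ a β M) n).prob
    rw [fieldLaw, ih, gremLevelLaw, gremLevelVar_eq_zero (hκ m hm), levelLaw_zero,
      Measure.conv_dirac_zero]

lemma gremKnat_eq_sum_range (κ : ℕ → ℕ) {n j : ℕ} (hj : j ≤ n) :
    gremKnat n (fun i => κ i) j = ∑ i ∈ Finset.range j, κ i := by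
  unfold gremKnat
  rw [Finset.sum_filter, Fin.sum_univ_eq_sum_range (fun i => if i < j then κ i else 0),
    ← Finset.sum_filter]
  congr 1
  ext i
  simp only [Finset.mem_filter, Finset.mem_range]
  omega

lemma integral_log_gremZ (κ : ℕ → ℕ) (a : ℕ → ℝ) (β : ℝ) (n : ℕ) :
    ∫ ω, Real.log (gremZ n (fun i => κ i) β ω)
        ∂(gremMeasure n (fun i => κ i) fun i => a i) =
      ∫ x, logSumExp x ∂(fieldLaw (gremLevelLaw κ a β (∑ j : Fin n, κ j)) n) := by
  set M := ∑ j : Fin n, κ j with hM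
  have hle (i : Fin n) : gremKnat n (fun i => κ i) ((i : ℕ) + 1) ≤ M :=
    Finset.sum_le_sum_of_subset (Finset.filter_subset _ _)
  have hK (i : Fin n) : gremKnat n (fun i => κ i) ((i : ℕ) + 1) =
      ∑ j ∈ Finset.range ((i : ℕ) + 1), κ j := gremKnat_eq_sum_range κ i.2
  have hMc : (∑ j : Fin n, (κ j : ℝ)) = M := by
    rw [hM]
    push_cast
    rfl
  let X : ∀ i : Fin n, ((Fin (gremKnat n (fun i => κ i) ((i : ℕ) + 1)) → Bool) → ℝ) →
      (Fin M → Bool) → ℝ := fun i h σ =>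
    (if 0 < κ i then β * √M else 0) * h (fun t => σ (Fin.castLE (hle i) t))
  have hX (i : Fin n) : Measurable (X i) := by fun_prop
  have hlaw (i : Fin n) : (Measure.pi fun _ => gaussianReal 0 (a i).toNNReal).map (X i) =
      gremLevelLaw κ a β M i := by
    let e : ({t : Fin M // (t : ℕ) < ∑ j ∈ Finset.range ((i : ℕ) + 1), κ j} → Bool) →
        Fin (gremKnat n (fun i => κ i) ((i : ℕ) + 1)) → Bool :=
      fun s t => s ⟨Fin.castLE (hle i) t, t.2.trans_eq (hK i)⟩
    have he : Function.Injective e := by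
      refine Function.Surjective.injective_comp_right fun t => ?_
      exact ⟨⟨t, t.2.trans_eq (hK i).symm⟩, rfl⟩
    unfold gremLevelLaw
    rw [← levelLaw_comp_of_injective he, levelLaw, gremLevelVar]
    have hg := gaussianReal_map_const_mul (μ := 0) (v := (a i).toNNReal)
      (if 0 < κ i then β * √M else 0)
    rw [mul_zero] at hg
    rw [← hg, ← Measure.pi_map_pi fun _ => by fun_prop,
      Measure.map_map (by fun_prop) (by fun_prop)]
    rfl
  have hsum : Measurable fun ω : (∀ i : Fin n,
      (Fin (gremKnat n (fun i => κ i) ((i : ℕ) + 1)) → Bool) → ℝ) => ∑ i, X i (ω i) :=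
    Finset.measurable_sum _ fun i _ => (hX i).comp (measurable_pi_apply i)
  rw [← map_sum_pi_eq_fieldLaw (gremLevelLaw κ a β M) (isIntegrableLaw_gremLevelLaw κ a β M) n
    (fun i => Measure.pi fun _ => gaussianReal 0 (a i).toNNReal) X hX hlaw,
    integral_map hsum.aemeasurable measurable_logSumExp.aestronglyMeasurable]
  unfold gremMeasure
  refine integral_congr_ae (.of_forall fun ω => ?_)
  unfold gremZ logSumExp gremH
  dsimp only
  congr 1
  refine Finset.sum_congr rfl fun σ _ => ?_
  congr 1
  rw [Finset.sum_apply, Finset.sum_filter, ← mul_assoc, Finset.mul_sum]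
  refine Finset.sum_congr rfl fun i _ => ?_
  simp only [X]
  split_ifs
  · rw [Nat.cast_sum, hMc]
    ring
  · simp

/-- Two GREMs whose level sizes add up to at most those of a third one. -/
lemma integral_logSumExp_gremLevelLaw_superadditive {κ κ₁ κ₂ : ℕ → ℕ}
    (h : ∀ i, κ₁ i + κ₂ i ≤ κ i) {n M M₁ M₂ : ℕ}
    (hM : M = ∑ i ∈ Finset.range n, κ i) (hM₁ : M₁ = ∑ i ∈ Finset.range n, κ₁ i)
    (hM₂ : M₂ = ∑ i ∈ Finset.range n, κ₂ i) (a : ℕ → ℝ) (β : ℝ) :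
    ((M : ℝ) - M₁ - M₂) * Real.log 2 +
        (∫ x, logSumExp x ∂(fieldLaw (gremLevelLaw κ₁ a β M₁) n) +
          ∫ x, logSumExp x ∂(fieldLaw (gremLevelLaw κ₂ a β M₂) n)) ≤
      ∫ x, logSumExp x ∂(fieldLaw (gremLevelLaw κ a β M) n) := by
  obtain ⟨E₁, E₂, h₁, h₂, i₁, i₂, hd⟩ := exists_level_embeddings h n
  rw [← hM₁] at i₁ hd
  rw [← hM₂] at i₂ hd
  have b₁ (t : Fin M₁) : E₁ t < M := hM ▸ h₁ n le_rfl t (hM₁ ▸ t.2)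
  have b₂ (t : Fin M₂) : E₂ t < M := hM ▸ h₂ n le_rfl t (hM₂ ▸ t.2)
  let e₁ : Fin M₁ → Fin M := fun t => ⟨E₁ t, b₁ t⟩
  let e₂ : Fin M₂ → Fin M := fun t => ⟨E₂ t, b₂ t⟩
  have he₁ : Function.Injective e₁ := fun s t hst =>
    Fin.ext (i₁ s.2 t.2 (congrArg Fin.val hst))
  have he₂ : Function.Injective e₂ := fun s t hst =>
    Fin.ext (i₂ s.2 t.2 (congrArg Fin.val hst))
  have he : Function.Injective (Sum.elim e₁ e₂) :=
    he₁.sumElim he₂ fun s t hst => hd s s.2 t t.2 (congrArg Fin.val hst)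
  have hlevel {κ' : ℕ → ℕ} {M' : ℕ} {E : ℕ → ℕ} (hM' : M' = ∑ i ∈ Finset.range n, κ' i)
      (hκ' : ∀ i, κ' i ≤ κ i)
      (hE : ∀ j ≤ n, ∀ x < ∑ i ∈ Finset.range j, κ' i, E x < ∑ i ∈ Finset.range j, κ i)
      (b : ∀ t : Fin M', E t < M) (i : ℕ) (σ τ : Fin M → Bool)
      (hστ : gremLabel κ M i σ = gremLabel κ M i τ) :
      gremLabel κ' M' i (fun t => σ ⟨E t, b t⟩) = gremLabel κ' M' i (fun t => τ ⟨E t, b t⟩) := by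
    funext t
    refine congrFun hστ ⟨⟨E t, b t⟩, ?_⟩
    rcases le_or_gt (i + 1) n with hi | hi
    · exact hE _ hi _ t.2
    · exact (hM ▸ b t).trans_le
        (Finset.sum_le_sum_of_subset (Finset.range_mono (by omega)))
  have hsurj {κ' : ℕ → ℕ} {M' : ℕ} {e : Fin M' → Fin M} (he : Function.Injective e) (i : ℕ) :
      Function.Surjective fun σ : Fin M → Bool => gremLabel κ' M' i (fun t => σ (e t)) :=
    (he.comp Subtype.val_injective).surjective_comp_right
  have hle : M₁ + M₂ ≤ M := by
    simpa using Fintype.card_le_of_injective _ he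
  have L := isIntegrableLaw_gremLevelLaw κ a β M
  have L₁ := isIntegrableLaw_gremLevelLaw κ₁ a β M₁
  have L₂ := isIntegrableLaw_gremLevelLaw κ₂ a β M₂
  have hcmp := fieldLaw_conv_fieldLaw_le
    (l₁ := fun i => levelLaw (fun σ : Fin M → Bool => gremLabel κ₁ M₁ i fun t => σ (e₁ t))
      (gremLevelVar κ₁ a β M₁ i))
    (l₂ := fun i => levelLaw (fun σ : Fin M → Bool => gremLabel κ₂ M₂ i fun t => σ (e₂ t))
      (gremLevelVar κ₂ a β M₂ i)) L (fun i => .levelLaw _ _) (fun i => .levelLaw _ _)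
    (fun i => levelLaw_conv_levelLaw_le (hsurj he₁ i) (hsurj he₂ i)
      (hlevel hM₁ (fun i => (Nat.le_add_right _ _).trans (h i)) h₁ b₁ i)
      (hlevel hM₂ (fun i => (Nat.le_add_left _ _).trans (h i)) h₂ b₂ i)
      (gremLevelVar_add_le h hle a β i)) n 0
  have ht := integral_logSumExp_tensor he (IsIntegrableLaw.fieldLaw L₁ n)
    (IsIntegrableLaw.fieldLaw L₂ n)
  rw [map_fieldLaw (fun (σ : Fin M → Bool) t => σ (e₁ t)) L₁,
    map_fieldLaw (fun (σ : Fin M → Bool) t => σ (e₂ t)) L₂] at ht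
  simp only [gremLevelLaw, map_levelLaw, Fintype.card_fin] at ht
  simp only [zero_add] at hcmp
  exact ht ▸ hcmp

lemma gremSeqK_add_le {alpha : ℕ → ℝ} (halpha : ∀ i, 1 < alpha i) (N₁ N₂ i : ℕ) :
    gremSeqK alpha N₁ i + gremSeqK alpha N₂ i ≤ gremSeqK alpha (N₁ + N₂) i := by
  have h (N : ℕ) : 0 ≤ (N : ℝ) * Real.log (alpha i) / Real.log 2 := by
    have := Real.log_pos (halpha i)
    have := Real.log_pos one_lt_two
    positivity
  unfold gremSeqK
  refine Nat.le_floor ?_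
  push_cast
  rw [add_mul, add_div]
  exact add_le_add (Nat.floor_le (h N₁)) (Nat.floor_le (h N₂))

lemma gremSeqK_eq_zero {alpha : ℕ → ℝ} (hs : Summable fun i => Real.log (alpha i)) {N i : ℕ}
    (hi : gremSeqLevels alpha N ≤ i) : gremSeqK alpha N i = 0 := by
  have ht : Filter.Tendsto (fun i => (N : ℝ) * Real.log (alpha i) / Real.log 2) Filter.atTop
      (nhds 0) := by
    simpa using (hs.tendsto_atTop_zero.const_mul (N : ℝ)).div_const (Real.log 2)
  obtain ⟨m, hm⟩ := Filter.eventually_atTop.1 (ht.eventually_lt_const one_pos)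
  have hbdd : BddAbove {i : ℕ | 0 < gremSeqK alpha N i} := by
    refine ⟨m, fun j hj => ?_⟩
    by_contra! hjm
    exact hj.ne' (Nat.floor_eq_zero.2 (hm j hjm.le))
  by_contra h
  have : i ≤ sSup {i : ℕ | 0 < gremSeqK alpha N i} := le_csSup hbdd (Nat.pos_of_ne_zero h)
  unfold gremSeqLevels at hi
  omega

lemma gremSeqKtot_eq_sum_range {alpha : ℕ → ℝ} {N n : ℕ} (h : ∀ i, n ≤ i → gremSeqK alpha N i = 0) :
    gremSeqKtot alpha N = (∑ i ∈ Finset.range n, gremSeqK alpha N i : ℕ) := by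
  unfold gremSeqKtot
  rw [tsum_eq_sum (s := Finset.range n) fun i hi => by simp [h i (by simpa using hi)]]
  push_cast
  rfl

lemma gremSeqAlpha_eq {alpha : ℕ → ℝ} (hs : Summable fun i => Real.log (alpha i)) (a : ℕ → ℝ)
    (β : ℝ) {N n : ℕ} (hn : gremSeqLevels alpha N ≤ n) :
    gremSeqAlpha alpha a β N = -∫ x, logSumExp x ∂(fieldLaw (gremLevelLaw (gremSeqK alpha N) a β
      (∑ i ∈ Finset.range n, gremSeqK alpha N i)) n) := by
  have h0 : ∀ i, gremSeqLevels alpha N ≤ i → gremSeqK alpha N i = 0 :=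
    fun i hi => gremSeqK_eq_zero hs hi
  have hM : ∑ j : Fin (gremSeqLevels alpha N), gremSeqK alpha N j =
      ∑ i ∈ Finset.range n, gremSeqK alpha N i := by
    rw [Fin.sum_univ_eq_sum_range (gremSeqK alpha N)]
    exact Finset.sum_subset (Finset.range_mono hn) fun i _ hi => h0 i (by simpa using hi)
  unfold gremSeqAlpha
  rw [integral_log_gremZ, hM, fieldLaw_gremLevelLaw_of_le h0 hn]

end Grem

/-- **Subadditivity for the GREM with infinitely many levels**: for `β > 0` and
`N = N₁ + N₂` with `N₁, N₂ ≥ 1`,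
`α_N(β) ≤ α_{N₁}(β) + α_{N₂}(β) − (|k(N)| − |k(N₁)| − |k(N₂)|) log 2`. -/
theorem grem_seq_subadditive (alpha a : ℕ → ℝ)
    (halpha : ∀ i, 1 < alpha i)
    (hlogsummable : Summable fun i => Real.log (alpha i))
    (hlogsum : ∑' i, Real.log (alpha i) = Real.log 2)
    (ha : ∀ i, 0 < a i) (hasummable : Summable a) (hasum : ∑' i, a i = 1)
    (β : ℝ) (hβ : 0 < β) (N₁ N₂ : ℕ) (h₁ : 1 ≤ N₁) (h₂ : 1 ≤ N₂) :
    gremSeqAlpha alpha a β (N₁ + N₂)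
      ≤ gremSeqAlpha alpha a β N₁ + gremSeqAlpha alpha a β N₂
        - (gremSeqKtot alpha (N₁ + N₂) - gremSeqKtot alpha N₁
            - gremSeqKtot alpha N₂) * Real.log 2 := by
  set n := max (gremSeqLevels alpha (N₁ + N₂))
    (max (gremSeqLevels alpha N₁) (gremSeqLevels alpha N₂))
  have hn : gremSeqLevels alpha (N₁ + N₂) ≤ n := le_max_left _ _
  have hn₁ : gremSeqLevels alpha N₁ ≤ n := (le_max_left _ _).trans (le_max_right _ _)
  have hn₂ : gremSeqLevels alpha N₂ ≤ n := (le_max_right _ _).trans (le_max_right _ _)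
  have h0 {N : ℕ} (hN : gremSeqLevels alpha N ≤ n) (i : ℕ) (hi : n ≤ i) :
      gremSeqK alpha N i = 0 := gremSeqK_eq_zero hlogsummable (hN.trans hi)
  have h := integral_logSumExp_gremLevelLaw_superadditive (gremSeqK_add_le halpha N₁ N₂)
    (n := n) rfl rfl rfl a β
  rw [gremSeqAlpha_eq hlogsummable a β hn, gremSeqAlpha_eq hlogsummable a β hn₁,
    gremSeqAlpha_eq hlogsummable a β hn₂, gremSeqKtot_eq_sum_range (h0 hn),
    gremSeqKtot_eq_sum_range (h0 hn₁), gremSeqKtot_eq_sum_range (h0 hn₂)]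
  linarith
end
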